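/- arXiv:1704.08482 — 2 statements merged into one kernel-verified Lean document; each statement's English description precedes it below -/
import Mathlib

section
/- Let n ≥ 1 and let X = (x_{i,j}) be an n×n integer matrix with all entries in {-1, 0, 1}. Then there exists an (n+2)×(n+2) integer matrix Z = (z_{i,j}) with all entries in {-1, 0, 1} and z_{n+2,n+2} = 0 such that, setting m = n+2 and defining the (m+n-1)×(m+n-1) matrix W = (w_{i,j}) by w_{i,j} = z_{i,j} for 1 ≤ i ≤ m−1 and 1 ≤ j ≤ m; w_{i,j} = 0 for 1 ≤ i ≤ m−1 and j > m; w_{m,j} = z_{m,j} for 1 ≤ j ≤ m−1; w_{m+i−1, m+j−1} = x_{i,j} for 1 ≤ i, j ≤ n; and w_{i,j} = 0 for i > m and j ≤ m−1, we have Per(W) = 0 and Per(Z^{m,m}) = Per(X^{1,1}). -/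
/-- The minor of a square matrix obtained by deleting row `i` and column `j`. -/
def matMinor {n : ℕ} (M : Matrix (Fin (n + 1)) (Fin (n + 1)) ℤ) (i j : Fin (n + 1)) :
    Matrix (Fin n) (Fin n) ℤ :=
  M.submatrix i.succAbove j.succAbove

/-- The `(m+n-1) × (m+n-1)` matrix `W` built (in 0-based indexing) from an `m × m` matrix `Z`
(with `m = μ+2`) and an `n × n` matrix `X` (with `n = ν+1`). -/
def blockW (μ ν : ℕ) (Z : Matrix (Fin (μ + 2)) (Fin (μ + 2)) ℤ)
    (X : Matrix (Fin (ν + 1)) (Fin (ν + 1)) ℤ) :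
    Matrix (Fin (μ + ν + 2)) (Fin (μ + ν + 2)) ℤ :=
  fun i j =>
    if hi : (i : ℕ) < μ + 1 then
      if hj : (j : ℕ) < μ + 2 then Z ⟨i, by omega⟩ ⟨j, hj⟩ else 0
    else
      if hj : (j : ℕ) < μ + 1 then
        if (i : ℕ) = μ + 1 then Z ⟨μ + 1, by omega⟩ ⟨j, by omega⟩ else 0
      else
        X ⟨(i : ℕ) - (μ + 1), by have := i.isLt; omega⟩
          ⟨(j : ℕ) - (μ + 1), by have := j.isLt; omega⟩

open Matrix

namespace Matrix

variable {R : Type*} [CommSemiring R] {α β : Type*} [Fintype α] [DecidableEq α]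
  [Fintype β] [DecidableEq β]

theorem permanent_submatrix_equiv (e f : α ≃ β) (M : Matrix β β R) :
    (M.submatrix e f).permanent = M.permanent := by
  unfold permanent
  refine Fintype.sum_equiv (f.equivCongr e) _ _ fun σ => ?_
  refine Fintype.prod_equiv f _ _ fun i => ?_
  simp

theorem permanent_fromBlocks_zero₂₁ (A : Matrix α α R) (B : Matrix α β R) (D : Matrix β β R) :
    (fromBlocks A B 0 D).permanent = A.permanent * D.permanent := by
  simp_rw [permanent]
  rw [Finset.sum_mul_sum, ← Finset.sum_product', Finset.univ_product_univ]
  symm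
  refine Finset.sum_of_injOn (fun σ => σ.1.sumCongr σ.2) ?_ (by simp) ?_ ?_
  · exact fun _ _ _ _ h => Equiv.Perm.sumCongrHom_injective h
  · intro σ _ hσ
    have h : ¬ Set.MapsTo σ (Set.range Sum.inl) (Set.range Sum.inl) := fun hm => by
      obtain ⟨p, hp⟩ := Equiv.Perm.mem_sumCongrHom_range_of_perm_mapsTo_inl hm
      exact hσ ⟨p, by simp, hp⟩
    obtain ⟨a, ha⟩ : ∃ a, σ (Sum.inl a) ∉ Set.range (Sum.inl : α → α ⊕ β) := by
      by_contra! hc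
      exact h (by rintro _ ⟨a, rfl⟩; exact hc a)
    apply Finset.prod_eq_zero (Finset.mem_univ (Sum.inl a))
    rcases hx : σ (Sum.inl a) with a' | b
    · exact absurd ⟨a', hx.symm⟩ ha
    · simp
  · intro σ _
    simp [Fintype.prod_sum_type]

theorem permanent_fromBlocks_zero₁₂ (A : Matrix α α R) (C : Matrix β α R) (D : Matrix β β R) :
    (fromBlocks A 0 C D).permanent = A.permanent * D.permanent := by
  rw [← permanent_transpose, fromBlocks_transpose, transpose_zero, permanent_fromBlocks_zero₂₁,
    permanent_transpose, permanent_transpose]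

theorem permanent_updateCol_add (M : Matrix α α R) (j : α) (u v : α → R) :
    (M.updateCol j (u + v)).permanent =
      (M.updateCol j u).permanent + (M.updateCol j v).permanent := by
  simp only [permanent, ← Finset.mul_prod_erase _ _ (Finset.mem_univ j), updateCol_self,
    Pi.add_apply, ← Finset.sum_add_distrib, add_mul]
  refine Finset.sum_congr rfl fun σ _ => ?_
  congr 2 <;>
  exact Finset.prod_congr rfl fun i hi => by simp [updateCol_ne (Finset.ne_of_mem_erase hi)]

theorem permanent_updateRow_add (M : Matrix α α R) (i : α) (u v : α → R) :
    (M.updateRow i (u + v)).permanent =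
      (M.updateRow i u).permanent + (M.updateRow i v).permanent := by
  simp only [← permanent_transpose (M.updateRow _ _), ← updateCol_transpose,
    permanent_updateCol_add]

/-- The matrix `A` with the column `b`, the row `c` and the corner entry `x` appended. -/
def bordered (A : Matrix α α R) (b c : α → R) (x : R) : Matrix (α ⊕ Fin 1) (α ⊕ Fin 1) R :=
  fromBlocks A (replicateCol (Fin 1) b) (replicateRow (Fin 1) c) (of fun _ _ => x)

/-- The matrix obtained from `bordered A b c 0` and `bordered Y s r x` by identifying their
border indices. -/
def glued (A : Matrix α α R) (b c : α → R) (Y : Matrix β β R) (s r : β → R) (x : R) :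
    Matrix (α ⊕ (Fin 1 ⊕ β)) (α ⊕ (Fin 1 ⊕ β)) R :=
  fromBlocks A (fromCols (replicateCol (Fin 1) b) 0) (fromRows (replicateRow (Fin 1) c) 0)
    (fromBlocks (of fun _ _ => x) (replicateRow (Fin 1) r) (replicateCol (Fin 1) s) Y)

theorem permanent_glued (A : Matrix α α R) (b c : α → R) (Y : Matrix β β R) (s r : β → R)
    (x : R) : (glued A b c Y s r x).permanent =
      A.permanent * (bordered Y s r x).permanent + (bordered A b c 0).permanent * Y.permanent := by
  have split : glued A b c Y s r x = (glued A b c Y s r x).updateRow (Sum.inr (Sum.inl 0))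
      (Sum.elim (fun _ => 0) (Sum.elim (fun _ => x) r) + Sum.elim c (fun _ => 0)) := by
    ext (i | i | i) (j | j | j) <;>
      simp [glued, updateRow_apply]
  have first : (glued A b c Y s r x).updateRow (Sum.inr (Sum.inl 0))
      (Sum.elim (fun _ => 0) (Sum.elim (fun _ => x) r)) =
      fromBlocks A (fromCols (replicateCol (Fin 1) b) 0) 0
        ((bordered Y s r x).submatrix (Equiv.sumComm _ _) (Equiv.sumComm _ _)) := by
    ext (i | i | i) (j | j | j) <;>
      simp [glued, bordered, updateRow_apply] <;> grind
  have second : ((glued A b c Y s r x).updateRow (Sum.inr (Sum.inl 0))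
        (Sum.elim c fun _ => 0)).submatrix
      (Equiv.sumAssoc α (Fin 1) β) (Equiv.sumAssoc α (Fin 1) β) =
      fromBlocks (bordered A b c 0) 0 (fromCols 0 (replicateCol (Fin 1) s)) Y := by
    ext ((i | i) | i) ((j | j) | j) <;>
      simp [glued, bordered, updateRow_apply] <;> grind
  rw [split, permanent_updateRow_add, first, permanent_fromBlocks_zero₂₁,
    permanent_submatrix_equiv,
    ← permanent_submatrix_equiv (Equiv.sumAssoc α (Fin 1) β) (Equiv.sumAssoc α (Fin 1) β),
    second, permanent_fromBlocks_zero₁₂]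

theorem permanent_bordered (A : Matrix α α R) (b c : α → R) (x : R) :
    (bordered A b c x).permanent = A.permanent * x + (bordered A b c 0).permanent := by
  have h := permanent_glued A b c (0 : Matrix (Fin 0) (Fin 0) R) 0 0 x
  have h₁ : (glued A b c (0 : Matrix (Fin 0) (Fin 0) R) 0 0 x).submatrix
      ((Equiv.refl α).sumCongr (Equiv.sumEmpty (Fin 1) (Fin 0)).symm)
      ((Equiv.refl α).sumCongr (Equiv.sumEmpty (Fin 1) (Fin 0)).symm) = bordered A b c x := by
    ext (i | i) (j | j) <;> simp [glued, bordered]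
  have h₂ : bordered (0 : Matrix (Fin 0) (Fin 0) R) 0 0 x =
      fromBlocks 0 0 0 (of fun _ _ => x) := by
    ext (i | i) (j | j)
    · exact i.elim0
    · exact i.elim0
    · exact j.elim0
    · rfl
  rwa [← permanent_submatrix_equiv
    ((Equiv.refl α).sumCongr (Equiv.sumEmpty (Fin 1) (Fin 0)).symm)
    ((Equiv.refl α).sumCongr (Equiv.sumEmpty (Fin 1) (Fin 0)).symm), h₁, h₂,
    permanent_fromBlocks_zero₁₂, permanent_isEmpty (n := Fin 0), one_mul, mul_one, permanent_unique (n := Fin 1),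
    of_apply] at h

theorem permanent_bordered_neg {S : Type*} [CommRing S] (A : Matrix α α S) (b c : α → S) :
    (bordered A b (-c) 0).permanent = -(bordered A b c 0).permanent := by
  have h := permanent_updateRow_smul (bordered A b c 0) (Sum.inr 0) (-1) (Sum.elim c fun _ => 0)
  have h₁ : (bordered A b c 0).updateRow (Sum.inr 0) ((-1 : S) • Sum.elim c fun _ => 0) =
      bordered A b (-c) 0 := by
    ext (i | i) (j | j) <;> simp [bordered, updateRow_apply] <;> grind
  have h₂ : (bordered A b c 0).updateRow (Sum.inr 0) (Sum.elim c fun _ => 0) =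
      bordered A b c 0 := by
    ext (i | i) (j | j) <;> simp [bordered, updateRow_apply]
  rwa [h₁, h₂, neg_one_mul] at h

end Matrix

theorem submatrix_eq_bordered_last {n : ℕ} (M : Matrix (Fin (n + 1)) (Fin (n + 1)) ℤ) :
    M.submatrix finSumFinEquiv finSumFinEquiv =
      bordered (matMinor M (Fin.last n) (Fin.last n)) (fun i => M i.castSucc (Fin.last n))
        (fun j => M (Fin.last n) j.castSucc) (M (Fin.last n) (Fin.last n)) := by
  have h (k : Fin 1) : Fin.natAdd n k = Fin.last n := by ext; simp
  ext (i | i) (j | j) <;> simp [bordered, matMinor, h] <;> rfl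

/-- The equivalence sending the border index to `0`. -/
def borderFirst (n : ℕ) : Fin n ⊕ Fin 1 ≃ Fin (n + 1) :=
  (Equiv.sumComm _ _).trans (finSumFinEquiv.trans (finCongr (add_comm 1 n)))

@[simp]
theorem borderFirst_inl {n : ℕ} (i : Fin n) : borderFirst n (Sum.inl i) = i.succ := by
  ext; simp [borderFirst]

@[simp]
theorem borderFirst_inr {n : ℕ} (i : Fin 1) : borderFirst n (Sum.inr i) = 0 := by
  ext; simp [borderFirst]

theorem submatrix_eq_bordered_zero {n : ℕ} (M : Matrix (Fin (n + 1)) (Fin (n + 1)) ℤ) :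
    M.submatrix (borderFirst n) (borderFirst n) =
      bordered (matMinor M 0 0) (fun i => M i.succ 0) (fun j => M 0 j.succ) (M 0 0) := by
  ext (i | i) (j | j) <;> simp [bordered, matMinor]

/-- The indexing of `blockW` by the indices before, at and after the common corner. -/
def blockWIndex (μ ν : ℕ) : Fin (μ + 1) ⊕ (Fin 1 ⊕ Fin ν) ≃ Fin (μ + ν + 2) :=
  ((Equiv.refl _).sumCongr finSumFinEquiv).trans
    (finSumFinEquiv.trans (finCongr (by omega)))

theorem blockW_submatrix (μ ν : ℕ) (Z : Matrix (Fin (μ + 2)) (Fin (μ + 2)) ℤ)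
    (X : Matrix (Fin (ν + 1)) (Fin (ν + 1)) ℤ) :
    (blockW μ ν Z X).submatrix (blockWIndex μ ν) (blockWIndex μ ν) =
      glued (matMinor Z (Fin.last _) (Fin.last _)) (fun i => Z i.castSucc (Fin.last _))
        (fun j => Z (Fin.last _) j.castSucc) (matMinor X 0 0) (fun i => X i.succ 0)
        (fun j => X 0 j.succ) (X 0 0) := by
  have hs (k : Fin ν) (h : 1 + (k : ℕ) < ν + 1) : (⟨1 + k, h⟩ : Fin (ν + 1)) = k.succ :=
    Fin.ext (add_comm _ _)
  have hlt (k : Fin (μ + 1)) : (k : ℕ) < μ + 2 := by omega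
  have hnle (t : ℕ) : ¬ μ + 1 + t ≤ μ := by omega
  have hnlt (t : ℕ) : ¬ μ + 1 + (1 + t) < μ + 2 := by omega
  ext (i | i | i) (j | j | j) <;>
    simp [glued, matMinor, blockW, blockWIndex, hs, hlt, hnle, hnlt, Fin.is_le] <;> rfl

theorem permanent_blockW (μ ν : ℕ) (Z : Matrix (Fin (μ + 2)) (Fin (μ + 2)) ℤ)
    (X : Matrix (Fin (ν + 1)) (Fin (ν + 1)) ℤ) (hZ : Z (Fin.last _) (Fin.last _) = 0) :
    (blockW μ ν Z X).permanent =
      (matMinor Z (Fin.last _) (Fin.last _)).permanent * X.permanent +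
        Z.permanent * (matMinor X 0 0).permanent := by
  rw [← permanent_submatrix_equiv (blockWIndex μ ν) (blockWIndex μ ν), blockW_submatrix,
    permanent_glued, ← submatrix_eq_bordered_zero, permanent_submatrix_equiv, ← hZ,
    ← submatrix_eq_bordered_last, permanent_submatrix_equiv]

/-- For every `(n+1) × (n+1)` integer matrix `X` with entries in `{-1, 0, 1}`
there is an `(n+3) × (n+3)` matrix `Z` with entries in `{-1, 0, 1}`, with bottom-right entry
`0`, such that the combined matrix `W` (with `m = n+3`) has permanent `0` and
`Per(Z^{m,m}) = Per(X^{1,1})`. -/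
theorem stmt2 (n : ℕ) (X : Matrix (Fin (n + 1)) (Fin (n + 1)) ℤ)
    (hX : ∀ i j, X i j = -1 ∨ X i j = 0 ∨ X i j = 1) :
    ∃ Z : Matrix (Fin (n + 3)) (Fin (n + 3)) ℤ,
      (∀ i j, Z i j = -1 ∨ Z i j = 0 ∨ Z i j = 1) ∧
      Z (Fin.last (n + 2)) (Fin.last (n + 2)) = 0 ∧
      (blockW (n + 1) n Z X).permanent = 0 ∧
      (matMinor Z (Fin.last (n + 2)) (Fin.last (n + 2))).permanent
        = (matMinor X 0 0).permanent := by
  obtain ⟨Y, hY⟩ : ∃ Y, Y = matMinor X 0 0 := ⟨_, rfl⟩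
  let s : Fin n → ℤ := fun i => X i.succ 0
  let r : Fin n → ℤ := fun j => X 0 j.succ
  let x : ℤ := X 0 0
  let G : Matrix (Fin n ⊕ (Fin 1 ⊕ Fin 2)) (Fin n ⊕ (Fin 1 ⊕ Fin 2)) ℤ :=
    glued Y s (-r) 1 ![-1, 0] ![x, 0] 0
  let a : Fin (n + 2) ≃ Fin n ⊕ Fin 2 := finSumFinEquiv.symm
  let e : Fin (n + 3) ≃ Fin n ⊕ (Fin 1 ⊕ Fin 2) :=
    (finSumFinEquiv (m := n + 2) (n := 1)).symm.trans
      ((a.sumCongr (Equiv.refl _)).trans ((Equiv.sumAssoc _ _ _).trans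
        ((Equiv.refl _).sumCongr (Equiv.sumComm _ _))))
  have he_last : e (Fin.last (n + 2)) = Sum.inr (Sum.inl 0) := by
    simp [e, finSumFinEquiv_symm_last]
  have he_castSucc (i : Fin (n + 2)) : e i.castSucc = Sum.map id Sum.inr (a i) := by
    have h : (finSumFinEquiv (m := n + 2) (n := 1)).symm i.castSucc =
        Sum.inl i := finSumFinEquiv_symm_apply_castAdd i
    simp only [e, Equiv.trans_apply, h]
    rcases hk : a i with k | k <;> simp [hk]
  have hminor : (matMinor (G.submatrix e e) (Fin.last (n + 2)) (Fin.last (n + 2))).permanent =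
      Y.permanent := by
    have h : matMinor (G.submatrix e e) (Fin.last (n + 2)) (Fin.last (n + 2)) =
        (fromBlocks Y 0 0 1).submatrix a a := by
      ext i j
      simp only [matMinor, submatrix_apply, Fin.succAbove_last, he_castSucc]
      rcases a i with k | k <;> rcases a j with l | l <;> simp [G, glued]
    rw [h, permanent_submatrix_equiv, permanent_fromBlocks_zero₁₂, permanent_one, mul_one]
  have hcorner : G.submatrix e e (Fin.last (n + 2)) (Fin.last (n + 2)) = 0 := by
    simp [he_last, G, glued]
  have hgadget : (bordered (1 : Matrix (Fin 2) (Fin 2) ℤ) ![-1, 0] ![x, 0] 0).permanent = -x := by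
    rcases hX 0 0 with h | h | h <;> simp only [x, h] <;> decide +kernel
  have hG : (G.submatrix e e).permanent = -X.permanent := by
    rw [permanent_submatrix_equiv, permanent_glued, hgadget, permanent_bordered_neg,
      permanent_one, ← permanent_submatrix_equiv (borderFirst n) (borderFirst n) X,
      submatrix_eq_bordered_zero, ← hY, permanent_bordered _ _ _ (X 0 0)]
    ring
  refine ⟨G.submatrix e e, fun i j => ?_, hcorner, ?_, hY ▸ hminor⟩
  · have hentry : ∀ u v, G u v = -1 ∨ G u v = 0 ∨ G u v = 1 := by
      rintro (i | i | i) (j | j | j)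
      · subst hY
        exact hX _ _
      · exact hX i.succ 0
      · exact Or.inr (Or.inl rfl)
      · have := hX 0 j.succ
        simp only [G, glued, fromBlocks_apply₂₁, fromRows_apply_inl, replicateRow_apply,
          Pi.neg_apply, r]
        omega
      · exact Or.inr (Or.inl rfl)
      · refine Fin.cases (hX 0 0) (fun k => ?_) j
        exact Or.inr (Or.inl (by simp [G, glued]))
      · exact Or.inr (Or.inl rfl)
      · refine Fin.cases (Or.inl rfl) (fun k => ?_) i
        rw [Fin.eq_zero k]
        exact Or.inr (Or.inl rfl)
      · simp only [G, glued, fromBlocks_apply₂₂, one_apply]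
        split_ifs <;> simp
    exact hentry _ _
  · rw [permanent_blockW _ _ _ _ hcorner, hminor, hG, ← hY]
    ring
end

section
/- Let n ≥ 1 and let l be such that 2ⁿ − 1 > l(l−1)/2. Let f : 𝔽₂ⁿ → 𝔽₂ⁿ be injective and let Q ⊆ 𝔽₂ⁿ be a set with |Q| ≤ l. Then there exist a nonzero s ∈ 𝔽₂ⁿ and a function f' : 𝔽₂ⁿ → 𝔽₂ⁿ such that f'(q) = f(q) for every q ∈ Q, and f' is a Simon function with period s: for all x, y ∈ 𝔽₂ⁿ, f'(x) = f'(y) if and only if y = x or y = x + s. -/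
theorem add_self_eq_zero_of_zmod_two {ι : Type*} (x : ι → ZMod 2) : x + x = 0 :=
  funext fun i => CharTwo.add_self_eq_zero (x i)

/-- The pairwise sums of distinct elements of `Q` take at most `Q.card.choose 2` values. -/
theorem card_image_add_offDiag_le {G : Type*} [AddCommMonoid G] [DecidableEq G] (Q : Finset G) :
    (Q.offDiag.image fun p => p.1 + p.2).card ≤ Q.card.choose 2 := by
  rw [← Sym2.card_image_offDiag]
  let g : Sym2 G → G := Sym2.lift ⟨fun a b => a + b, add_comm⟩
  have hg : (Q.offDiag.image fun p => p.1 + p.2) = (Q.offDiag.image Sym2.mk.uncurry).image g := by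
    rw [Finset.image_image]
    rfl
  rw [hg]
  exact Finset.card_image_le

/-- A function injective on `𝔽₂ⁿ` agrees, on any set with no two elements differing by `s`,
with a function that is two-to-one with period `s`. -/
theorem exists_simon_function {n : ℕ} {β : Type*} (f : (Fin n → ZMod 2) → β)
    (hf : Function.Injective f) (Q : Set (Fin n → ZMod 2)) {s : Fin n → ZMod 2} (hs : s ≠ 0)
    (hQ : ∀ x ∈ Q, x + s ∉ Q) :
    ∃ f' : (Fin n → ZMod 2) → β, (∀ q ∈ Q, f' q = f q) ∧
      ∀ x y, f' x = f' y ↔ (y = x ∨ y = x + s) := by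
  classical
  obtain ⟨i, hi⟩ := Function.ne_iff.mp hs
  have hss : ∀ x : Fin n → ZMod 2, x + s + s = x := fun x => by
    rw [add_assoc, add_self_eq_zero_of_zmod_two, add_zero]
  have hzero : ∀ a b : ZMod 2, b ≠ 0 → (a + b = 0 ↔ a ≠ 0) := by decide
  let P : (Fin n → ZMod 2) → Prop := fun x => x ∈ Q ∨ (x + s ∉ Q ∧ x i = 0)
  have hP : ∀ x, P (x + s) ↔ ¬ P x := fun x => by
    have h₁ := hQ x
    have h₂ := hzero (x i) (s i) hi
    simp only [P, hss, Pi.add_apply]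
    tauto
  let r : (Fin n → ZMod 2) → (Fin n → ZMod 2) := fun x => if P x then x else x + s
  have hr : ∀ x, r (x + s) = r x := fun x => by
    by_cases hx : P x <;> simp [r, hP, hx, hss]
  refine ⟨f ∘ r, fun q hq => ?_, fun x y => ?_⟩
  · have : P q := Or.inl hq
    simp [r, this]
  · simp only [Function.comp_apply, hf.eq_iff]
    constructor
    · intro h
      by_cases hx : P x <;> by_cases hy : P y <;> simp only [r, hx, hy, if_true, if_false] at h
      · exact Or.inl h.symm
      · exact Or.inr (by rw [h, hss])
      · exact Or.inr h.symm
      · exact Or.inl (add_right_cancel h).symm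
    · rintro (rfl | rfl)
      · rfl
      · exact (hr x).symm


/-- Let `n ≥ 1` and `l` satisfy `2ⁿ - 1 > l(l-1)/2`. For every injective
`f : 𝔽₂ⁿ → 𝔽₂ⁿ` and every set `Q ⊆ 𝔽₂ⁿ` with `|Q| ≤ l`, there exist a nonzero `s` and a
function `f'` agreeing with `f` on `Q` which is a Simon function with period `s`:
`f'(x) = f'(y)` iff `y = x` or `y = x + s`. -/
theorem stmt8 (n l : ℕ) (hn : 1 ≤ n) (h : l * (l - 1) / 2 < 2 ^ n - 1)
    (f : (Fin n → ZMod 2) → (Fin n → ZMod 2)) (hf : Function.Injective f)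
    (Q : Finset (Fin n → ZMod 2)) (hQ : Q.card ≤ l) :
    ∃ s : Fin n → ZMod 2, s ≠ 0 ∧
      ∃ f' : (Fin n → ZMod 2) → (Fin n → ZMod 2),
        (∀ q ∈ Q, f' q = f q) ∧
        ∀ x y, f' x = f' y ↔ (y = x ∨ y = x + s) := by
  have hcard : (insert 0 (Q.offDiag.image fun p => p.1 + p.2)).card <
      (Finset.univ : Finset (Fin n → ZMod 2)).card := by
    have h₁ := card_image_add_offDiag_le Q
    have h₂ := Nat.choose_le_choose 2 hQ
    rw [Nat.choose_two_right l] at h₂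
    have h₃ := Finset.card_insert_le 0 (Q.offDiag.image fun p => p.1 + p.2)
    rw [Finset.card_univ, Fintype.card_fun, ZMod.card, Fintype.card_fin]
    omega
  obtain ⟨s, -, hs⟩ := Finset.exists_mem_notMem_of_card_lt_card hcard
  rw [Finset.mem_insert, not_or] at hs
  obtain ⟨hs₀, hs⟩ := hs
  refine ⟨s, hs₀, exists_simon_function f hf Q hs₀ fun x hx hxs => hs ?_⟩
  refine Finset.mem_image.mpr ⟨(x, x + s), Finset.mem_offDiag.mpr ⟨hx, hxs, ?_⟩, ?_⟩
  · simpa using hs₀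
  · rw [← add_assoc, add_self_eq_zero_of_zmod_two, zero_add]
end
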